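/- arXiv:1108.4192 — 2 statements merged into one kernel-verified Lean document; each statement's English description precedes it below -/
import Mathlib

section
/- Let Γ be a countably infinite group, f ∈ ℤΓ well-balanced, and (Γ_n)_{n≥1} a sequence of finite-index normal subgroups of Γ with ⋂_{n≥1} ⋃_{i≥n} Γ_i = {e}. Let λ_n be the Haar probability measure of the compact abelian group Fix_{Γ_n}(X_f), regarded as a Borel probability measure on X_f via the inclusion, and let λ be the Haar probability measure of X_f. Then λ_n converges to λ in the weak* topology: for every continuous function φ : X_f → ℝ, ∫ φ dλ_n → ∫ φ dλ as n → ∞. -/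
open Filter Topology MeasureTheory

/-- `f ∈ ℤΓ` is well-balanced. -/
def WellBalancedZ {G : Type*} [Group G] (f : G → ℤ) : Prop :=
  (Function.support f).Finite ∧ (∑ᶠ s : G, f s) = 0 ∧
    (∀ s : G, s ≠ 1 → f s ≤ 0) ∧ (∀ s : G, f s⁻¹ = f s) ∧
    Subgroup.closure (Function.support f) = ⊤

/-- `X_f = {x ∈ (ℝ/ℤ)^Γ : ∀ t, ∑_s f_s · x_{ts} = 0}`. -/
def XfSet {G : Type*} [Group G] (f : G → ℤ) : Set (G → UnitAddCircle) :=
  {x | ∀ t : G, (∑ᶠ s : G, f s • x (t * s)) = 0}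

/-- `Fix_N(X_f) = {x ∈ X_f : x_{γt} = x_t for all γ ∈ N, t ∈ Γ}`. -/
def fixSet {G : Type*} [Group G] (f : G → ℤ) (N : Subgroup G) :
    Set (G → UnitAddCircle) :=
  {x | x ∈ XfSet f ∧ ∀ γ ∈ N, ∀ t : G, x (γ * t) = x t}


open scoped Pointwise

/-- In a group generated by a symmetric set `E`, a nonempty set stable under right multiplication
by `E` is everything. -/
lemma eq_univ_of_mul_mem {Q : Type*} [Group Q] {E : Set Q} (hinv : ∀ s ∈ E, s⁻¹ ∈ E)
    (hE : Subgroup.closure E = ⊤) {D : Set Q} (hD : ∀ w ∈ D, ∀ s ∈ E, w * s ∈ D)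
    (hne : D.Nonempty) : D = Set.univ := by
  obtain ⟨d, hd⟩ := hne
  have key : ∀ x ∈ Subgroup.closure E, ∀ w ∈ D, w * x ∈ D ∧ w * x⁻¹ ∈ D := by
    intro x hx
    induction hx using Subgroup.closure_induction with
    | mem x hx => exact fun w hw => ⟨hD w hw x hx, hD w hw _ (hinv x hx)⟩
    | one => intro w hw; simpa using hw
    | mul x y _ _ ihx ihy =>
      intro w hw
      refine ⟨?_, ?_⟩
      · rw [← mul_assoc]; exact (ihy _ (ihx w hw).1).1
      · rw [mul_inv_rev, ← mul_assoc]; exact (ihx _ (ihy w hw).2).2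
    | inv x _ ih => intro w hw; simpa using (ih w hw).symm
  refine Set.eq_univ_of_forall fun y => ?_
  simpa using (key (d⁻¹ * y) (by rw [hE]; trivial) d hd).1

/-- In a finite Cayley graph, a set containing at most half of the vertices whose boundary lies in
the ball of radius `r` is contained in the ball of radius `2 r`. -/
lemma subset_of_boundary_subset {Q : Type*} [Group Q] [Finite Q] {E : Set Q} (h1 : 1 ∈ E)
    (hinv : ∀ s ∈ E, s⁻¹ ∈ E) (hE : Subgroup.closure E = ⊤) {A : Set Q} {r : ℕ}
    (hA : ∀ w, ∀ s ∈ E, ¬ (w ∈ A ↔ w * s ∈ A) → w ∈ E ^ r)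
    (hcard : A.ncard ≤ Aᶜ.ncard) : A ⊆ E ^ r * E ^ r := by
  intro a ha
  by_contra hB
  have hEinv : (E ^ r)⁻¹ = E ^ r := by
    rw [← inv_pow]
    congr 1
    ext x
    exact ⟨fun h => by simpa using hinv _ h, fun h => hinv _ h⟩
  have hmono : ∀ k ≤ r, E ^ k ⊆ E ^ r := fun k hk => Set.pow_subset_pow_right h1 hk
  have hdisj : ∀ b ∈ E ^ r, a * b ∉ E ^ r := by
    intro b hb hab
    refine hB ⟨a * b, hab, b⁻¹, ?_, by simp⟩
    rw [← hEinv]; simpa using hb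
  have hsub : ∀ k ≤ r, ∀ b ∈ E ^ k, a * b ∈ A := by
    intro k
    induction k with
    | zero => intro _ b hb; simp at hb; simpa [hb] using ha
    | succ k ih =>
      intro hk b hb
      rw [pow_succ] at hb
      obtain ⟨c, hc, s, hs, rfl⟩ := hb
      have := ih (by omega) c hc
      by_contra hn
      refine hdisj c (hmono k (by omega) hc) (hA _ s hs ?_)
      simp only [mul_assoc] at hn ⊢
      tauto
  set A' : Set Q := (fun x => a * x) '' A with hA'
  have memA' : ∀ x, x ∈ A' ↔ a⁻¹ * x ∈ A := by
    intro x
    constructor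
    · rintro ⟨y, hy, rfl⟩; simpa using hy
    · intro h; exact ⟨_, h, by simp⟩
  have hbd : ∀ w, ∀ s ∈ E, ¬ (w ∈ A' ↔ w * s ∈ A') → a⁻¹ * w ∈ E ^ r := by
    intro w s hs h
    rw [memA', memA', ← mul_assoc] at h
    exact hA _ s hs h
  have hball : ∀ k ≤ r, ∀ b ∈ E ^ k, (b ∈ A' ↔ (1 : Q) ∈ A') := by
    intro k
    induction k with
    | zero => intro _ b hb; simp at hb; simp [hb]
    | succ k ih =>
      intro hk b hb
      rw [pow_succ] at hb
      obtain ⟨c, hc, s, hs, rfl⟩ := hb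
      rw [← ih (by omega) c hc]
      by_contra hn
      have h := hbd c s hs (fun h => hn h.symm)
      exact hdisj _ h (by simpa using hmono k (by omega) hc)
  have hcompl : ∀ x ∉ A, (x ∈ A' ↔ (1 : Q) ∈ A') := by
    by_contra! hcon
    obtain ⟨x, hx, hx'⟩ := hcon
    have := eq_univ_of_mul_mem hinv hE (D := {x | x ∉ A ∧ ¬ (x ∈ A' ↔ (1 : Q) ∈ A')})
      (by
        rintro w ⟨hw, hw'⟩ s hs
        have hwB : w ∉ E ^ r := fun h => hw' (hball r le_rfl w h)
        have e1 : w ∈ A ↔ w * s ∈ A := by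
          by_contra h; exact hwB (hA w s hs h)
        have e2 : w ∈ A' ↔ w * s ∈ A' := by
          by_contra h
          exact hw (by simpa using hsub r le_rfl _ (hbd w s hs h))
        exact ⟨by rwa [← e1], by rwa [← e2]⟩) ⟨x, hx, by tauto⟩
    have h1' : (1 : Q) ∈ {x | x ∉ A ∧ ¬ (x ∈ A' ↔ (1 : Q) ∈ A')} := by rw [this]; trivial
    exact h1'.2 Iff.rfl
  have hc1 : A'.ncard = A.ncard := Set.ncard_image_of_injective _ (mul_right_injective a)
  have hsum := Set.ncard_add_ncard_compl A
  have hsum' := Set.ncard_add_ncard_compl A'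
  have hle : A.ncard ≤ (A \ E ^ r).ncard := by
    by_cases h : (1 : Q) ∈ A'
    · refine le_trans (by omega : A.ncard ≤ A'ᶜ.ncard) (Set.ncard_le_ncard ?_)
      intro x hx
      refine ⟨?_, fun hxB => hx ((hball r le_rfl x hxB).2 h)⟩
      by_contra hxA
      exact hx ((hcompl x hxA).2 h)
    · refine le_trans hc1.ge (Set.ncard_le_ncard ?_)
      intro x hx
      refine ⟨?_, fun hxB => h ((hball r le_rfl x hxB).1 hx)⟩
      by_contra hxA
      exact h ((hcompl x hxA).1 hx)
  have heq : A \ E ^ r = A := Set.eq_of_subset_of_ncard_le Set.sdiff_subset hle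
  have huniv := eq_univ_of_mul_mem hinv hE (D := A) (by
    intro w hw s hs
    by_contra h
    exact (heq.symm ▸ hw : w ∈ A \ E ^ r).2 (hA w s hs (by tauto))) ⟨a, ha⟩
  rw [huniv] at hcard
  simp only [Set.compl_univ, Set.ncard_empty, Set.ncard_univ] at hcard
  have := Nat.card_pos (α := Q)
  omega

/-- A function on a finite Cayley graph whose non-constant edges lie in the ball of radius `r` is
constant off the ball of radius `2 r`. -/
lemma exists_const_off_ball {Q R : Type*} [Group Q] [Finite Q] {E : Set Q} (h1 : 1 ∈ E)
    (hinv : ∀ s ∈ E, s⁻¹ ∈ E) (hE : Subgroup.closure E = ⊤) {h : Q → R} {r : ℕ}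
    (hh : ∀ w, ∀ s ∈ E, h (w * s) ≠ h w → w ∈ E ^ r) :
    ∃ c, ∀ x ∉ E ^ r * E ^ r, h x = c := by
  by_contra! hcon
  obtain ⟨x, hx, -⟩ := hcon (h 1)
  obtain ⟨y, hy, hxy⟩ := hcon (h x)
  rcases le_total ({z | h z = h x} : Set Q).ncard ({z | h z = h x}ᶜ : Set Q).ncard with hle | hle
  · refine hx (subset_of_boundary_subset h1 hinv hE (fun w s hs hn => hh w s hs ?_) hle rfl)
    intro he; exact hn (by simp [he])
  · refine hy (subset_of_boundary_subset h1 hinv hE (fun w s hs hn => hh w s hs ?_)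
      (by rwa [compl_compl]) hxy)
    intro he; exact hn (by simp [he])

/-- Green's identity for the Laplacian of a finite quotient of `G`. -/
lemma green_identity {G Q : Type*} [Group G] [Group Q] [Fintype Q] {f : G → ℤ} {S : Finset G}
    (hS : ∀ s ∈ S, s⁻¹ ∈ S) (hsymm : ∀ s, f s⁻¹ = f s) (hsum : ∑ s ∈ S, f s = 0)
    (π : G →* Q) (u h : Q → ℤ) :
    2 * ∑ x, u x * ∑ s ∈ S, f s * h (x * π s) =
      ∑ x, ∑ s ∈ S, -f s * ((u x - u (x * π s)) * (h x - h (x * π s))) := by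
  have e1 : ∑ x, ∑ s ∈ S, f s * (u x * h x) = 0 := by
    simp [← Finset.sum_mul, hsum]
  have e2 : ∑ x, ∑ s ∈ S, f s * (u (x * π s) * h (x * π s)) = 0 := by
    rw [Finset.sum_comm, ← e1, Finset.sum_comm (s := Finset.univ)]
    refine Finset.sum_congr rfl fun s _ => ?_
    exact Fintype.sum_equiv (Equiv.mulRight (π s)) _ _ (fun x => rfl)
  have e3 : ∑ x, ∑ s ∈ S, f s * (u (x * π s) * h x) =
      ∑ x, ∑ s ∈ S, f s * (u x * h (x * π s)) := by
    rw [Finset.sum_comm, Finset.sum_comm (s := Finset.univ)]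
    refine Finset.sum_nbij' (fun s => s⁻¹) (fun s => s⁻¹) hS hS (by simp) (by simp) ?_
    intro s _
    refine Fintype.sum_equiv (Equiv.mulRight (π s)) _ _ (fun x => ?_)
    simp [hsymm]
  have e4 : ∑ x, u x * ∑ s ∈ S, f s * h (x * π s) =
      ∑ x, ∑ s ∈ S, f s * (u x * h (x * π s)) := by
    simp only [Finset.mul_sum]
    exact Finset.sum_congr rfl fun x _ => Finset.sum_congr rfl fun s _ => by ring
  have e5 : ∑ x, ∑ s ∈ S, -f s * ((u x - u (x * π s)) * (h x - h (x * π s))) =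
      - ∑ x, ∑ s ∈ S, f s * (u x * h x)
      - ∑ x, ∑ s ∈ S, f s * (u (x * π s) * h (x * π s))
      + ∑ x, ∑ s ∈ S, f s * (u x * h (x * π s))
      + ∑ x, ∑ s ∈ S, f s * (u (x * π s) * h x) := by
    simp only [← Finset.sum_neg_distrib, ← Finset.sum_sub_distrib, ← Finset.sum_add_distrib]
    exact Finset.sum_congr rfl fun x _ => Finset.sum_congr rfl fun s _ => by ring
  rw [e5, e4, e1, e2, e3]
  ring

/-- `h : Q → ℤ` is a potential of (the image in `Q` of) `g` for the Laplacian given by `f`. -/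
def IsPotential {G Q : Type*} [Group G] [Group Q] (f : G → ℤ) (π : G →* Q)
    (g : G →₀ ℤ) (h : Q → ℤ) : Prop :=
  ∀ S : Finset G, Function.support f ⊆ S → ∀ w,
    ∑ s ∈ S, f s * h (w * π s) = Finsupp.mapDomain π g w

/-- The support of `f` together with the identity. -/
def nbhd {G : Type*} [Group G] (f : G → ℤ) : Set G := insert 1 (Function.support f)

lemma one_mem_nbhd {G : Type*} [Group G] (f : G → ℤ) : 1 ∈ nbhd f := Set.mem_insert _ _

namespace WellBalancedZ

variable {G : Type*} [Group G] {f : G → ℤ}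

lemma inv_mem_nbhd (hf : WellBalancedZ f) {s : G} (hs : s ∈ nbhd f) : s⁻¹ ∈ nbhd f := by
  rcases hs with rfl | hs
  · simp [nbhd]
  · right
    simpa [hf.2.2.2.1 s] using hs

lemma closure_nbhd (hf : WellBalancedZ f) : Subgroup.closure (nbhd f) = ⊤ :=
  top_le_iff.1 (hf.2.2.2.2.ge.trans (Subgroup.closure_mono (Set.subset_insert _ _)))

lemma finite_nbhd (hf : WellBalancedZ f) : (nbhd f).Finite := hf.1.insert 1

lemma finite_pow (hf : WellBalancedZ f) (k : ℕ) : (nbhd f ^ k).Finite := by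
  induction k with
  | zero => simp
  | succ k ih => rw [pow_succ]; exact ih.mul hf.finite_nbhd

lemma sum_nbhd (hf : WellBalancedZ f) : ∑ s ∈ hf.finite_nbhd.toFinset, f s = 0 := by
  rw [← hf.2.1, finsum_eq_sum_of_support_subset]
  simp [nbhd]

lemma exists_mem_pow (hf : WellBalancedZ f) (x : G) : ∃ k, x ∈ nbhd f ^ k := by
  have := eq_univ_of_mul_mem (fun s hs => hf.inv_mem_nbhd hs) hf.closure_nbhd
    (D := {x | ∃ k, x ∈ nbhd f ^ k}) (by
      rintro w ⟨k, hk⟩ s hs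
      exact ⟨k + 1, by rw [pow_succ]; exact Set.mul_mem_mul hk hs⟩) ⟨1, 0, by simp⟩
  exact this.ge (Set.mem_univ x)

lemma exists_subset_pow (hf : WellBalancedZ f) (T : Finset G) : ∃ k, (T : Set G) ⊆ nbhd f ^ k := by
  choose k hk using hf.exists_mem_pow
  refine ⟨T.sup k, fun x hx => ?_⟩
  exact Set.pow_subset_pow_right (one_mem_nbhd f) (Finset.le_sup (f := k) hx) (hk x)

lemma inv_mem_pow (hf : WellBalancedZ f) {k : ℕ} {x : G} (hx : x ∈ nbhd f ^ k) :
    x⁻¹ ∈ nbhd f ^ k := by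
  have h : (nbhd f)⁻¹ = nbhd f := by
    ext x
    exact ⟨fun h => by simpa using hf.inv_mem_nbhd h, fun h => hf.inv_mem_nbhd h⟩
  have : (nbhd f ^ k)⁻¹ = nbhd f ^ k := by rw [← inv_pow, h]
  rw [← this]
  simpa using hx

variable {Q : Type*} [Group Q] {π : G →* Q} {g : G →₀ ℤ} {h : Q → ℤ}

lemma isPotential_neg (hh : IsPotential f π g h) : IsPotential f π (-g) (-h) := by
  intro S hS w
  have : Finsupp.mapDomain π (-g) = - Finsupp.mapDomain π g :=
    map_neg (Finsupp.mapDomain.addMonoidHom π) g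
  simp [this, ← hh S hS w]

lemma isPotential_sub_const (hf : WellBalancedZ f) (hh : IsPotential f π g h) (c : ℤ) :
    IsPotential f π g (fun x => h x - c) := by
  intro S hS w
  have h0 : ∑ s ∈ S, f s = 0 := by
    rw [← hf.2.1, finsum_eq_sum_of_support_subset _ hS]
  simp only [mul_sub, Finset.sum_sub_distrib, ← Finset.sum_mul, h0, hh S hS w]
  simp

lemma exists_lt_mul (hf : WellBalancedZ f) (hh : IsPotential f π g h) {w : Q}
    (hw : ∃ s ∈ nbhd f, h (w * π s) ≠ h w) (hg : ∀ a ∈ g.support, π a ≠ w) :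
    ∃ s ∈ nbhd f, h w < h (w * π s) := by
  by_contra! hcon
  obtain ⟨s, hs, hsw⟩ := hw
  have h0 : Finsupp.mapDomain π g w = 0 := by
    classical
    by_contra hne
    have := Finsupp.mapDomain_support (Finsupp.mem_support_iff.2 hne)
    obtain ⟨a, ha, rfl⟩ := Finset.mem_image.1 this
    exact hg a ha rfl
  have h1 := hf.isPotential_sub_const hh (h w) hf.finite_nbhd.toFinset
    (by simp [nbhd]) w
  rw [h0, Finset.sum_eq_zero_iff_of_nonneg] at h1
  · have h2 := h1 s (by simpa using hs)
    rcases hs with rfl | hs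
    · simp at hsw
    · rcases mul_eq_zero.1 h2 with h3 | h3
      · exact hs h3
      · exact hsw (by linarith)
  · intro t ht
    by_cases h1 : t = 1
    · simp [h1]
    · exact mul_nonneg_of_nonpos_of_nonpos (hf.2.2.1 t h1)
        (by linarith [hcon t (by simpa using ht)])

/-- Each step along an edge changes a potential of `g` by at most `2 ‖g‖₁`. -/
lemma sub_mul_le [Finite Q] (hf : WellBalancedZ f) (hh : IsPotential f π g h) (w : Q) {s : G}
    (hs : s ∈ nbhd f) : h w - h (w * π s) ≤ 2 * ∑ a ∈ g.support, |g a| := by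
  classical
  cases nonempty_fintype Q
  have hC : 0 ≤ ∑ a ∈ g.support, |g a| := Finset.sum_nonneg fun _ _ => abs_nonneg _
  by_cases hle : h w ≤ h (w * π s)
  · linarith
  push Not at hle
  have hs1 : s ≠ 1 := by rintro rfl; simp at hle
  have hfs : f s ≤ -1 := by
    have h1 := hf.2.2.1 s hs1
    have h2 : f s ≠ 0 := by rcases hs with h | h; exacts [absurd h hs1, h]
    omega
  set S := hf.finite_nbhd.toFinset with hS
  set u : Q → ℤ := fun x => if h w ≤ h x then 1 else 0 with hu
  have hgreen := green_identity (S := S) (by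
    intro t ht
    simpa [hS] using hf.inv_mem_nbhd (by simpa [hS] using ht)) hf.2.2.2.1 hf.sum_nbhd π u h
  have hnn : ∀ x, ∀ t ∈ S, 0 ≤ -f t * ((u x - u (x * π t)) * (h x - h (x * π t))) := by
    intro x t _
    by_cases ht1 : t = 1
    · simp [ht1]
    refine mul_nonneg (by linarith [hf.2.2.1 t ht1]) ?_
    simp only [hu]
    split_ifs <;> nlinarith
  have hterm : h w - h (w * π s) ≤
      -f s * ((u w - u (w * π s)) * (h w - h (w * π s))) := by
    simp only [hu, le_refl, if_true, if_neg (not_le.2 hle)]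
    nlinarith
  have hbig : h w - h (w * π s) ≤
      ∑ x, ∑ t ∈ S, -f t * ((u x - u (x * π t)) * (h x - h (x * π t))) :=
    calc _ ≤ _ := hterm
      _ ≤ ∑ t ∈ S, -f t * ((u w - u (w * π t)) * (h w - h (w * π t))) :=
        Finset.single_le_sum (f := fun t => -f t * ((u w - u (w * π t)) * (h w - h (w * π t))))
          (hnn w) (by simpa [hS] using hs)
      _ ≤ _ := Finset.single_le_sum
          (f := fun x => ∑ t ∈ S, -f t * ((u x - u (x * π t)) * (h x - h (x * π t))))
          (fun x _ => Finset.sum_nonneg (hnn x)) (Finset.mem_univ w)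
  have hflux : ∑ x, u x * ∑ t ∈ S, f t * h (x * π t) = ∑ a ∈ g.support, g a * u (π a) := by
    have e : ∑ x, u x * ∑ t ∈ S, f t * h (x * π t) =
        (Finsupp.mapDomain π g).sum (fun x n => n * u x) := by
      rw [Finsupp.sum_fintype _ _ (by simp)]
      exact Finset.sum_congr rfl fun x _ => by rw [hh S (by simp [hS, nbhd]) x, mul_comm]
    rw [e, Finsupp.sum_mapDomain_index (by simp) (by intros; ring)]
    rfl
  have hle2 : ∑ a ∈ g.support, g a * u (π a) ≤ ∑ a ∈ g.support, |g a| := by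
    refine Finset.sum_le_sum fun a _ => ?_
    simp only [hu]
    split_ifs
    · simpa using le_abs_self _
    · simp
  rw [hflux] at hgreen
  linarith

lemma sub_mul_pow_le [Finite Q] (hf : WellBalancedZ f) (hh : IsPotential f π g h) {k : ℕ} :
    ∀ (w : Q), ∀ x ∈ nbhd f ^ k, h w - h (w * π x) ≤ k * (2 * ∑ a ∈ g.support, |g a|) := by
  induction k with
  | zero => intro w x hx; simp at hx; simp [hx]
  | succ k ih =>
    intro w x hx
    rw [pow_succ] at hx
    obtain ⟨y, hy, s, hs, rfl⟩ := hx
    have h1 := ih w y hy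
    have h2 := hf.sub_mul_le hh (w * π y) hs
    simp only [map_mul, ← mul_assoc] at h2 ⊢
    push_cast
    linarith

lemma closure_image_nbhd (hf : WellBalancedZ f) (hπ : Function.Surjective π) :
    Subgroup.closure (π '' nbhd f) = ⊤ := by
  rw [← MonoidHom.map_closure, hf.closure_nbhd, Subgroup.map_top_of_surjective _ hπ]

lemma inv_mem_image_nbhd (hf : WellBalancedZ f) : ∀ s ∈ π '' nbhd f, s⁻¹ ∈ π '' nbhd f := by
  rintro _ ⟨s, hs, rfl⟩
  exact ⟨s⁻¹, hf.inv_mem_nbhd hs, by simp⟩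

/-- Maximum principle: a non-constant potential of `g` attains its maximum on the support
of `g`. -/
lemma exists_max [Finite Q] (hf : WellBalancedZ f) (hπ : Function.Surjective π)
    (hh : IsPotential f π g h) (hne : ∃ x y, h x ≠ h y) :
    ∃ a ∈ g.support, ∀ x, h x ≤ h (π a) := by
  obtain ⟨m, hm⟩ := Finite.exists_max h
  by_contra! hcon
  have huniv := eq_univ_of_mul_mem hf.inv_mem_image_nbhd (hf.closure_image_nbhd hπ)
    (D := {x | h x = h m}) (by
      rintro w hw _ ⟨s, hs, rfl⟩
      by_contra hws
      obtain ⟨t, _, ht⟩ := hf.exists_lt_mul hh (w := w)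
        ⟨s, hs, fun he => hws (he.trans hw)⟩ (by
          rintro a ha rfl
          obtain ⟨x, hx⟩ := hcon a ha
          have hw' : h (π a) = h m := hw
          linarith [hm x])
      have hw' : h w = h m := hw
      linarith [hm (w * π t)]) ⟨m, rfl⟩
  obtain ⟨x, y, hxy⟩ := hne
  have hx : h x = h m := huniv.ge (Set.mem_univ x)
  have hy : h y = h m := huniv.ge (Set.mem_univ y)
  exact hxy (hx.trans hy.symm)

lemma sub_le [Finite Q] (hf : WellBalancedZ f) (hπ : Function.Surjective π)
    (hh : IsPotential f π g h) {p : ℕ} (hp : (g.support : Set G) ⊆ nbhd f ^ p) (x y : Q) :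
    h x - h y ≤ (p + p : ℕ) * (2 * ∑ a ∈ g.support, |g a|) := by
  by_cases hne : ∃ x y, h x ≠ h y
  · obtain ⟨a, ha, hamax⟩ := hf.exists_max hπ hh hne
    obtain ⟨b, hb, hbmax⟩ := hf.exists_max hπ (isPotential_neg hh) (by simpa using hne)
    have hab := hf.sub_mul_pow_le hh (k := p + p) (π a) (a⁻¹ * b) (by
      rw [pow_add]
      exact Set.mul_mem_mul (hf.inv_mem_pow (hp ha)) (hp (by simpa using hb)))
    have h1 := hamax x
    have h2 := hbmax y
    simp only [map_mul, map_inv, mul_inv_cancel_left, Pi.neg_apply] at hab h2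
    linarith
  · push Not at hne
    rw [hne x y, sub_self]
    exact mul_nonneg (by positivity)
      (mul_nonneg (by norm_num) (Finset.sum_nonneg fun _ _ => abs_nonneg _))

lemma exists_climb (hf : WellBalancedZ f) (hh : IsPotential f π g h) (k : ℕ) :
    ∀ w, (∃ s ∈ nbhd f, h (w * π s) ≠ h w) → ∃ x ∈ nbhd f ^ k,
      (∃ a ∈ g.support, π a = w * π x) ∨
        (h w + k ≤ h (w * π x) ∧ ∃ s ∈ nbhd f, h (w * π x * π s) ≠ h (w * π x)) := by
  induction k with
  | zero => intro w hw; exact ⟨1, by simp, Or.inr (by simpa using hw)⟩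
  | succ k ih =>
    intro w hw
    obtain ⟨x, hx, hxw | ⟨hxw, hxs⟩⟩ := ih w hw
    · exact ⟨x, Set.pow_subset_pow_right (one_mem_nbhd f) (Nat.le_succ k) hx, Or.inl hxw⟩
    by_cases ha : ∃ a ∈ g.support, π a = w * π x
    · exact ⟨x, Set.pow_subset_pow_right (one_mem_nbhd f) (Nat.le_succ k) hx, Or.inl ha⟩
    push Not at ha
    obtain ⟨s, hs, hlt⟩ := hf.exists_lt_mul hh hxs ha
    refine ⟨x * s, by rw [pow_succ]; exact Set.mul_mem_mul hx hs, Or.inr ⟨?_, s⁻¹,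
      hf.inv_mem_nbhd hs, ?_⟩⟩
    · rw [map_mul, ← mul_assoc]
      push_cast
      linarith
    · simp only [map_mul, map_inv, ← mul_assoc, mul_inv_cancel_right]
      exact hlt.ne

/-- The radius, depending only on `f` and `g`, of a ball such that in every finite quotient the
potentials of `g` are constant off (the image of) that ball. -/
lemma exists_radius (hf : WellBalancedZ f) (g : G →₀ ℤ) :
    ∃ m : ℕ, (g.support : Set G) ⊆ nbhd f ^ m ∧
      ∀ (N : Subgroup G) [N.Normal] [N.FiniteIndex] (h : G ⧸ N → ℤ),
        IsPotential f (QuotientGroup.mk' N) g h →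
        ∃ c, ∀ x ∉ QuotientGroup.mk' N '' (nbhd f ^ m), h x = c := by
  obtain ⟨p, hp⟩ := hf.exists_subset_pow g.support
  set R : ℕ := ((p + p : ℕ) * (2 * ∑ a ∈ g.support, |g a|)).toNat with hR
  set r : ℕ := p + (R + 1) with hr
  refine ⟨r + r, hp.trans (Set.pow_subset_pow_right (one_mem_nbhd f) (by omega)), ?_⟩
  intro N _ _ h hh
  have hπ := QuotientGroup.mk'_surjective N
  set π := QuotientGroup.mk' N
  obtain ⟨c, hc⟩ := exists_const_off_ball (E := π '' nbhd f) (h := h) (r := r)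
    ⟨1, one_mem_nbhd f, by simp⟩ hf.inv_mem_image_nbhd (hf.closure_image_nbhd hπ) (by
      rintro w _ ⟨s, hs, rfl⟩ hws
      obtain ⟨x, hx, ⟨a, ha, hax⟩ | ⟨hle, -⟩⟩ := hf.exists_climb hh (R + 1) w ⟨s, hs, hws⟩
      · rw [← Set.image_pow]
        refine ⟨a * x⁻¹, ?_, by simp [hax]⟩
        rw [hr, pow_add]
        exact Set.mul_mem_mul (hp ha) (hf.inv_mem_pow hx)
      · have h1 := hf.sub_le hπ hh hp (w * π x) w
        have h2 := Int.self_le_toNat ((p + p : ℕ) * (2 * ∑ a ∈ g.support, |g a|))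
        rw [← hR] at h2
        push_cast at hle h1 h2
        linarith)
  refine ⟨c, fun x hx => hc x ?_⟩
  rwa [← pow_add, ← Set.image_pow]

end WellBalancedZ

/-- The left translate by `q` of the image of `F` under `π`. -/
noncomputable def leftTranslate {G Q : Type*} [Group G] [Group Q] (π : G →* Q) (F : G →₀ ℤ) (q : Q) :
    Q →₀ ℤ :=
  Finsupp.mapDomain (fun s => q * π s) F

lemma linearCombination_leftTranslate_apply {G Q : Type*} [Group G] [Group Q] (π : G →* Q)
    {F : G →₀ ℤ} (hsymm : ∀ s, F s⁻¹ = F s) (c : Q →₀ ℤ) (w : Q) :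
    Finsupp.linearCombination ℤ (leftTranslate π F) c w = ∑ s ∈ F.support, F s * c (w * π s) := by
  classical
  induction c using Finsupp.induction_linear with
  | zero => simp
  | add c d hc hd => simp [hc, hd, mul_add, Finset.sum_add_distrib]
  | single q n =>
    simp only [Finsupp.linearCombination_single, leftTranslate, Finsupp.mapDomain, Finsupp.sum,
      Finsupp.smul_apply, Finsupp.finsetSum_apply, Finsupp.single_apply, smul_eq_mul,
      Finset.mul_sum]
    have hS : ∀ s ∈ F.support, s⁻¹ ∈ F.support := fun s hs => by simpa [hsymm] using hs
    refine Finset.sum_nbij' (fun s => s⁻¹) (fun s => s⁻¹) hS hS (by simp) (by simp) ?_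
    intro s _
    have : (q * π s = w) ↔ (q = w * π s⁻¹) := by rw [map_inv, eq_mul_inv_iff_mul_eq]
    simp only [this, hsymm]
    split_ifs <;> ring

namespace WellBalancedZ

variable {G : Type*} [Group G] {f : G → ℤ}

/-- A well-balanced element as a finitely supported function. -/
noncomputable def toFinsupp (hf : WellBalancedZ f) : G →₀ ℤ := Finsupp.ofSupportFinite f hf.1

@[simp] lemma toFinsupp_apply (hf : WellBalancedZ f) (s : G) : hf.toFinsupp s = f s := rfl

/-- The left ideal `ℤΓ f`. -/
noncomputable def leftIdeal (hf : WellBalancedZ f) : Submodule ℤ (G →₀ ℤ) :=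
  Submodule.span ℤ (Set.range (leftTranslate (MonoidHom.id G) hf.toFinsupp))

/-- The sum of the left ideal `ℤΓ f` and the kernel of `ℤΓ → ℤ(Γ/N)`. -/
noncomputable def leftIdealMod (hf : WellBalancedZ f) (N : Subgroup G) : Submodule ℤ (G →₀ ℤ) :=
  Submodule.span ℤ (Set.range (leftTranslate (MonoidHom.id G) hf.toFinsupp) ∪
    {d | ∃ γ ∈ N, ∃ t, d = Finsupp.single (γ * t) 1 - Finsupp.single t 1})

lemma sum_support_toFinsupp (hf : WellBalancedZ f) {S : Finset G} (hS : Function.support f ⊆ S)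
    (u : G → ℤ) : ∑ s ∈ hf.toFinsupp.support, f s * u s = ∑ s ∈ S, f s * u s := by
  refine Finset.sum_subset (fun s hs => hS (by simpa using hs)) fun s _ hs => ?_
  have : f s = 0 := by simpa using hs
  simp [this]

/-- If `g` belongs to `ℤΓ f` modulo `N`, then its image in `ℤ(Γ/N)` has an integral potential. -/
lemma exists_potential (hf : WellBalancedZ f) {N : Subgroup G} [N.Normal] {g : G →₀ ℤ}
    (hg : g ∈ hf.leftIdealMod N) :
    ∃ h : G ⧸ N → ℤ, IsPotential f (QuotientGroup.mk' N) g h := by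
  set π := QuotientGroup.mk' N
  have hle : hf.leftIdealMod N ≤ (Submodule.span ℤ (Set.range (leftTranslate π hf.toFinsupp))).comap
      (Finsupp.lmapDomain ℤ ℤ π) := by
    refine Submodule.span_le.2 ?_
    rintro _ (⟨t, rfl⟩ | ⟨γ, hγ, t, rfl⟩)
    · refine Submodule.subset_span ⟨π t, ?_⟩
      simp only [leftTranslate, Finsupp.lmapDomain_apply, ← Finsupp.mapDomain_comp]
      congr 1
    · have : π γ = 1 := (QuotientGroup.eq_one_iff γ).2 hγ
      rw [SetLike.mem_coe, Submodule.mem_comap, map_sub]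
      simp [this]
  obtain ⟨c, hc⟩ := Finsupp.mem_span_range_iff_exists_finsupp.1 (hle hg)
  refine ⟨c, fun S hS w => ?_⟩
  have h1 := linearCombination_leftTranslate_apply π (F := hf.toFinsupp) hf.2.2.2.1 c w
  rw [Finsupp.linearCombination_apply, hc] at h1
  rw [← hf.sum_support_toFinsupp hS (fun s => c (w * π s))]
  exact h1.symm

/-- Membership in `ℤΓ f` is detected modulo any normal subgroup of finite index that avoids a
finite set depending only on `f` and `g`. -/
lemma exists_finite_forall_mem_leftIdeal (hf : WellBalancedZ f) (g : G →₀ ℤ) :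
    ∃ K : Set G, K.Finite ∧ ∀ (N : Subgroup G) [N.Normal] [N.FiniteIndex],
      (∀ γ ∈ N, γ ∈ K → γ = 1) → g ∈ hf.leftIdealMod N → g ∈ hf.leftIdeal := by
  classical
  obtain ⟨m, hgm, hm⟩ := hf.exists_radius g
  refine ⟨nbhd f ^ (m + 2) * nbhd f ^ (m + 2), ?_, ?_⟩
  · have : (nbhd f ^ (m + 2)).Finite := hf.finite_pow _
    exact this.mul this
  intro N _ _ hK hgN
  obtain ⟨h', hh'⟩ := hf.exists_potential hgN
  obtain ⟨c, hc⟩ := hm N h' hh'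
  have hh := hf.isPotential_sub_const hh' c
  set h := fun x => h' x - c
  have hh0 : ∀ x ∉ QuotientGroup.mk' N '' (nbhd f ^ m), h x = 0 := fun x hx => by
    simp [h, hc x hx]
  set π := QuotientGroup.mk' N
  have hinj : Set.InjOn π (nbhd f ^ (m + 2)) := by
    intro x hx y hy hxy
    have : x⁻¹ * y ∈ N := QuotientGroup.eq.1 hxy
    exact inv_mul_eq_one.1 (hK _ this (Set.mul_mem_mul (hf.inv_mem_pow hx) hy))
  have hmono : ∀ {k l : ℕ}, k ≤ l → nbhd f ^ k ⊆ nbhd f ^ l := fun hkl =>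
    Set.pow_subset_pow_right (one_mem_nbhd f) hkl
  have hfinm : (nbhd f ^ m).Finite := hf.finite_pow _
  set c' : G →₀ ℤ := Finsupp.onFinset hfinm.toFinset
    (fun x => if x ∈ nbhd f ^ m then h (π x) else 0) (by intro x hx; simp at hx; simp [hx.1])
    with hc'
  have hc'x : ∀ x, c' x = if x ∈ nbhd f ^ m then h (π x) else 0 := fun _ => rfl
  refine Finsupp.mem_span_range_iff_exists_finsupp.2 ⟨c', ?_⟩
  rw [← Finsupp.linearCombination_apply]
  ext w
  rw [linearCombination_leftTranslate_apply _ hf.2.2.2.1]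
  by_cases hw : w ∈ nbhd f ^ (m + 1)
  · have hgw : Finsupp.mapDomain π g (π w) = g w := by
      rw [Finsupp.mapDomain, Finsupp.sum_apply, Finsupp.sum_eq_single w]
      · simp
      · intro a ha haw
        rw [Finsupp.single_apply, if_neg]
        intro he
        exact haw (hinj (hmono (by omega) (hgm (by simpa using ha))) (hmono (by omega) hw) he)
      · simp
    rw [← hgw, ← hh hf.toFinsupp.support (by intro s hs; simpa using hs) (π w)]
    refine Finset.sum_congr rfl fun s hs => ?_
    have hs' : s ∈ nbhd f := Or.inr (by simpa using hs)
    simp only [toFinsupp_apply, MonoidHom.id_apply, hc'x, ← map_mul]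
    split_ifs with hws
    · rfl
    · rw [hh0]
      rintro ⟨y, hy, hyw⟩
      refine hws ?_
      rw [← hinj (hmono (by omega) hy) ?_ hyw]
      · exact hy
      · rw [pow_succ]
        exact Set.mul_mem_mul hw hs'
  · have hgw : g w = 0 := by
      by_contra hne
      exact hw (hmono (by omega) (hgm (by simpa using hne)))
    rw [hgw]
    refine Finset.sum_eq_zero fun s hs => ?_
    have hs' : s ∈ nbhd f := Or.inr (by simpa using hs)
    rw [hc'x, if_neg, mul_zero]
    intro hws
    refine hw ?_
    rw [pow_succ]
    exact ⟨_, hws, s⁻¹, hf.inv_mem_nbhd hs', by simp⟩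

lemma linearCombination_leftTranslate (hf : WellBalancedZ f) (x : G → UnitAddCircle) (t : G) :
    Finsupp.linearCombination ℤ x (leftTranslate (MonoidHom.id G) hf.toFinsupp t) =
      ∑ᶠ s, f s • x (t * s) := by
  rw [leftTranslate, Finsupp.linearCombination_mapDomain, Finsupp.linearCombination_apply,
    Finsupp.sum, finsum_eq_sum_of_support_subset]
  · rfl
  · intro s hs
    have : f s ≠ 0 := by rintro h0; simp [h0] at hs
    simpa using this

lemma mem_XfSet_iff (hf : WellBalancedZ f) (x : G → UnitAddCircle) :
    x ∈ XfSet f ↔ ∀ g ∈ hf.leftIdeal, Finsupp.linearCombination ℤ x g = 0 := by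
  change _ ↔ hf.leftIdeal ≤ LinearMap.ker (Finsupp.linearCombination ℤ x)
  simp only [leftIdeal, Submodule.span_le, Set.range_subset_iff, SetLike.mem_coe,
    LinearMap.mem_ker, hf.linearCombination_leftTranslate]
  rfl

lemma mem_fixSet_iff (hf : WellBalancedZ f) (N : Subgroup G) (x : G → UnitAddCircle) :
    x ∈ fixSet f N ↔ ∀ g ∈ hf.leftIdealMod N, Finsupp.linearCombination ℤ x g = 0 := by
  change _ ↔ hf.leftIdealMod N ≤ LinearMap.ker (Finsupp.linearCombination ℤ x)
  simp only [leftIdealMod, Submodule.span_le, Set.range_subset_iff, SetLike.mem_coe,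
    LinearMap.mem_ker, hf.linearCombination_leftTranslate, Set.union_subset_iff]
  refine and_congr Iff.rfl ⟨?_, fun h γ hγ t => ?_⟩
  · rintro h _ ⟨γ, hγ, t, rfl⟩
    simp [h γ hγ t]
  · have : Finsupp.linearCombination ℤ x (Finsupp.single (γ * t) 1 - Finsupp.single t 1) = 0 :=
      h ⟨γ, hγ, t, rfl⟩
    simpa [sub_eq_zero] using this

lemma leftIdeal_le (hf : WellBalancedZ f) (N : Subgroup G) : hf.leftIdeal ≤ hf.leftIdealMod N :=
  Submodule.span_mono Set.subset_union_left

end WellBalancedZ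

/-- Characters with values in `ℝ/ℤ` separate the points of a discrete abelian group. -/
lemma exists_unitAddCircle_hom_ne_zero {A : Type*} [AddCommGroup A] {a : A} (ha : a ≠ 0) :
    ∃ χ : A →+ UnitAddCircle, χ a ≠ 0 := by
  obtain ⟨c, hc⟩ := CharacterModule.exists_character_apply_ne_zero_of_ne_zero ha
  let ι : AddCircle (1 : ℚ) →+ UnitAddCircle :=
    QuotientAddGroup.map _ _ (Rat.castHom ℝ).toAddMonoidHom (by
      rw [AddSubgroup.zmultiples_le]
      exact ⟨1, by simp⟩)
  refine ⟨ι.comp c, fun h => hc ?_⟩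
  obtain ⟨q, hq⟩ := QuotientAddGroup.mk_surjective (c a)
  have h' : ι (c a) = 0 := h
  rw [← hq] at h' ⊢
  have h2 : ((q : ℝ) : UnitAddCircle) = 0 := h'
  obtain ⟨n, hn⟩ := (AddCircle.coe_eq_zero_iff (1 : ℝ)).1 h2
  refine (AddCircle.coe_eq_zero_iff (1 : ℚ)).2 ⟨n, ?_⟩
  simp only [zsmul_eq_mul, mul_one] at hn ⊢
  exact_mod_cast hn

/-- An element outside a submodule `J` of `ℤΓ` is detected by a point of the annihilator of `J`. -/
lemma exists_annihilator_ne_zero {G : Type*} {J : Submodule ℤ (G →₀ ℤ)} {g : G →₀ ℤ}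
    (hg : g ∉ J) : ∃ x : G → UnitAddCircle,
      (∀ j ∈ J, Finsupp.linearCombination ℤ x j = 0) ∧ Finsupp.linearCombination ℤ x g ≠ 0 := by
  obtain ⟨χ, hχ⟩ := exists_unitAddCircle_hom_ne_zero
    (a := J.mkQ g) (by simpa using hg)
  have key : Finsupp.linearCombination ℤ (fun s => χ (J.mkQ (Finsupp.single s 1))) =
      χ.toIntLinearMap ∘ₗ J.mkQ := by
    ext s
    simp
  refine ⟨fun s => χ (J.mkQ (Finsupp.single s 1)), fun j hj => ?_, ?_⟩
  · rw [key]
    have : J.mkQ j = 0 := by simpa using hj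
    simp only [LinearMap.comp_apply, this, map_zero]
  · rw [key]
    exact hχ

/-- The character of `(ℝ/ℤ)^Γ` given by `g ∈ ℤΓ`. -/
noncomputable def torusChar {G : Type*} (g : G →₀ ℤ) : C(G → UnitAddCircle, ℂ) where
  toFun x := fourier 1 (Finsupp.linearCombination ℤ x g)
  continuous_toFun := by
    refine (map_continuous (fourier 1)).comp ?_
    simp only [Finsupp.linearCombination_apply, Finsupp.sum]
    fun_prop

section torusChar

variable {G : Type*}

lemma torusChar_apply (g : G →₀ ℤ) (x : G → UnitAddCircle) :
    torusChar g x = (AddCircle.toCircle (Finsupp.linearCombination ℤ x g) : ℂ) := by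
  simp [torusChar, fourier_apply]

lemma torusChar_add (g h : G →₀ ℤ) : torusChar (g + h) = torusChar g * torusChar h := by
  ext x
  simp [torusChar_apply, AddCircle.toCircle_add]

lemma torusChar_zero : torusChar (0 : G →₀ ℤ) = 1 := by
  ext x
  simp [torusChar_apply]

lemma torusChar_neg (g : G →₀ ℤ) : torusChar (-g) = star (torusChar g) := by
  ext x
  rw [ContinuousMap.star_apply, torusChar_apply, torusChar_apply, map_neg,
    AddCircle.toCircle_neg, Circle.coe_inv_eq_conj]
  rfl

lemma torusChar_apply_add (g : G →₀ ℤ) (x y : G → UnitAddCircle) :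
    torusChar g (x + y) = torusChar g x * torusChar g y := by
  have : Finsupp.linearCombination ℤ (x + y) g =
      Finsupp.linearCombination ℤ x g + Finsupp.linearCombination ℤ y g := by
    simp [Finsupp.linearCombination_apply, Finsupp.sum, smul_add, Finset.sum_add_distrib]
  simp [torusChar_apply, this, AddCircle.toCircle_add]

lemma torusChar_eq_one_iff (g : G →₀ ℤ) (x : G → UnitAddCircle) :
    torusChar g x = 1 ↔ Finsupp.linearCombination ℤ x g = 0 := by
  rw [torusChar_apply, Circle.coe_eq_one, ← AddCircle.toCircle_zero (T := (1 : ℝ)),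
    (AddCircle.injective_toCircle one_ne_zero).eq_iff]

/-- Trigonometric polynomials are dense in the continuous functions on `(ℝ/ℤ)^Γ`. -/
lemma span_torusChar_closure_eq_top :
    (Submodule.span ℂ (Set.range (torusChar (G := G)))).topologicalClosure = ⊤ := by
  let A : StarSubalgebra ℂ C(G → UnitAddCircle, ℂ) :=
    { Algebra.adjoin ℂ (Set.range (torusChar (G := G))) with
      star_mem' := by
        change Algebra.adjoin ℂ (Set.range (torusChar (G := G))) ≤
          star (Algebra.adjoin ℂ (Set.range (torusChar (G := G))))
        refine Algebra.adjoin_le ?_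
        rintro _ ⟨g, rfl⟩
        exact Algebra.subset_adjoin ⟨-g, torusChar_neg g⟩ }
  have hA : Subalgebra.toSubmodule A.toSubalgebra =
      Submodule.span ℂ (Set.range (torusChar (G := G))) := by
    refine (Algebra.adjoin_eq_span_of_subset _ ?_)
    refine Set.Subset.trans ?_ Submodule.subset_span
    intro x hx
    induction hx using Submonoid.closure_induction with
    | mem x hx => exact hx
    | one => exact ⟨0, torusChar_zero⟩
    | mul x y _ _ hx hy =>
      obtain ⟨g, rfl⟩ := hx
      obtain ⟨h, rfl⟩ := hy
      exact ⟨g + h, torusChar_add g h⟩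
  have hsep : A.SeparatesPoints := by
    intro x y hxy
    obtain ⟨s, hs⟩ := Function.ne_iff.1 hxy
    refine ⟨_, ⟨torusChar (Finsupp.single s 1), Algebra.subset_adjoin ⟨_, rfl⟩, rfl⟩, ?_⟩
    simp only [torusChar_apply, Finsupp.linearCombination_single, one_smul]
    intro h
    exact hs (AddCircle.injective_toCircle one_ne_zero (Subtype.coe_injective h))
  have htop := ContinuousMap.starSubalgebra_topologicalClosure_eq_top_of_separatesPoints A hsep
  rw [← hA]
  ext φ
  simp only [Submodule.mem_top, iff_true]
  have : φ ∈ A.topologicalClosure := by rw [htop]; trivial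
  exact this

variable [Countable G]

lemma integrable_continuousMap (μ : Measure (G → UnitAddCircle)) [IsProbabilityMeasure μ]
    (φ : C(G → UnitAddCircle, ℂ)) : Integrable φ μ :=
  Integrable.of_bound (map_continuous φ).aestronglyMeasurable ‖φ‖
    (Eventually.of_forall φ.norm_coe_le_norm)

lemma integral_torusChar_eq_one {μ : Measure (G → UnitAddCircle)} [IsProbabilityMeasure μ]
    {X : Set (G → UnitAddCircle)} (hX : μ X = 1) {g : G →₀ ℤ}
    (hg : ∀ x ∈ X, Finsupp.linearCombination ℤ x g = 0) : ∫ x, torusChar g x ∂μ = 1 := by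
  have hcl : MeasurableSet {x | torusChar g x = 1} :=
    (isClosed_eq (map_continuous _) continuous_const).measurableSet
  have hμ : μ {x | torusChar g x = 1} = 1 :=
    le_antisymm prob_le_one (hX ▸ measure_mono fun x hx => (torusChar_eq_one_iff g x).2 (hg x hx))
  have hae : ∀ᵐ x ∂μ, torusChar g x = 1 := (prob_compl_eq_zero_iff hcl).2 hμ
  rw [integral_congr_ae hae]
  simp

lemma integral_torusChar_eq_zero {μ : Measure (G → UnitAddCircle)} {x : G → UnitAddCircle}
    (hinv : Measure.map (fun y => y + x) μ = μ) {g : G →₀ ℤ}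
    (hg : Finsupp.linearCombination ℤ x g ≠ 0) : ∫ y, torusChar g y ∂μ = 0 := by
  have h : ∫ y, torusChar g y ∂μ = (∫ y, torusChar g y ∂μ) * torusChar g x := by
    conv_lhs => rw [← hinv]
    rw [integral_map (by fun_prop) (map_continuous _).aestronglyMeasurable]
    simp only [torusChar_apply_add, integral_mul_const]
  by_contra hne
  exact hg ((torusChar_eq_one_iff g x).1 (mul_left_cancel₀ hne (by rw [← h, mul_one])))

/-- Weak convergence of probability measures on `(ℝ/ℤ)^Γ` can be tested on characters. -/
lemma tendsto_integral_of_torusChar {μn : ℕ → Measure (G → UnitAddCircle)}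
    {μ : Measure (G → UnitAddCircle)} [∀ n, IsProbabilityMeasure (μn n)] [IsProbabilityMeasure μ]
    (h : ∀ g, Tendsto (fun n => ∫ x, torusChar g x ∂(μn n)) atTop (𝓝 (∫ x, torusChar g x ∂μ)))
    (φ : C(G → UnitAddCircle, ℂ)) :
    Tendsto (fun n => ∫ x, φ x ∂(μn n)) atTop (𝓝 (∫ x, φ x ∂μ)) := by
  have hspan : ∀ ψ ∈ Submodule.span ℂ (Set.range (torusChar (G := G))),
      Tendsto (fun n => ∫ x, ψ x ∂(μn n)) atTop (𝓝 (∫ x, ψ x ∂μ)) := by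
    intro ψ hψ
    induction hψ using Submodule.span_induction with
    | mem ψ hψ => obtain ⟨g, rfl⟩ := hψ; exact h g
    | zero => simp
    | add ψ₁ ψ₂ _ _ h₁ h₂ =>
      simp only [ContinuousMap.add_apply]
      simp_rw [integral_add (integrable_continuousMap _ ψ₁) (integrable_continuousMap _ ψ₂)]
      exact h₁.add h₂
    | smul c ψ _ hψ =>
      simp only [ContinuousMap.smul_apply, integral_smul]
      exact hψ.const_smul c
  have hclose : ∀ (ν : Measure (G → UnitAddCircle)) [IsProbabilityMeasure ν]
      (ψ : C(G → UnitAddCircle, ℂ)), ‖(∫ x, φ x ∂ν) - ∫ x, ψ x ∂ν‖ ≤ ‖φ - ψ‖ := by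
    intro ν _ ψ
    rw [← integral_sub (integrable_continuousMap _ φ) (integrable_continuousMap _ ψ)]
    refine (norm_integral_le_of_norm_le_const
      (Eventually.of_forall (φ - ψ).norm_coe_le_norm)).trans ?_
    simp
  rw [Metric.tendsto_atTop]
  intro ε hε
  have hφ : φ ∈ closure (Submodule.span ℂ (Set.range (torusChar (G := G))) : Set _) := by
    rw [← Submodule.topologicalClosure_coe, span_torusChar_closure_eq_top]
    trivial
  obtain ⟨ψ, hψ, hd⟩ := Metric.mem_closure_iff.1 hφ (ε / 3) (by positivity)
  rw [dist_eq_norm] at hd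
  obtain ⟨n₀, hn₀⟩ := Metric.tendsto_atTop.1 (hspan ψ hψ) (ε / 3) (by positivity)
  refine ⟨n₀, fun n hn => ?_⟩
  have h1 := hclose (μn n) ψ
  have h2 := hclose μ ψ
  have h3 := hn₀ n hn
  have h4 := dist_triangle4 (∫ x, φ x ∂(μn n)) (∫ x, ψ x ∂(μn n)) (∫ x, ψ x ∂μ) (∫ x, φ x ∂μ)
  rw [dist_eq_norm (∫ x, φ x ∂(μn n)) (∫ x, ψ x ∂(μn n)), dist_comm (∫ x, ψ x ∂μ),
    dist_eq_norm (∫ x, φ x ∂μ)] at h4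
  linarith

end torusChar

/-- The subgroups `N n` eventually avoid every finite set of nontrivial elements. -/
lemma eventually_avoid_finite {G : Type*} [Group G] {N : ℕ → Subgroup G}
    (hconv : (⋂ n : ℕ, ⋃ i : ℕ, ⋃ (_ : n ≤ i), ((N i : Set G))) = {1})
    {K : Set G} (hK : K.Finite) : ∀ᶠ n in atTop, ∀ γ ∈ N n, γ ∈ K → γ = 1 := by
  have : ∀ γ ∈ K, ∀ᶠ n in atTop, γ ∈ N n → γ = 1 := by
    intro γ _
    by_cases h1 : γ = 1
    · simp [h1]
    have hγ : γ ∉ ⋂ n : ℕ, ⋃ i : ℕ, ⋃ (_ : n ≤ i), ((N i : Set G)) := by simpa [hconv] using h1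
    simp only [Set.mem_iInter, Set.mem_iUnion, not_forall, not_exists] at hγ
    obtain ⟨n, hn⟩ := hγ
    filter_upwards [eventually_ge_atTop n] with i hi hmem
    exact absurd hmem (hn i hi)
  filter_upwards [(eventually_all_finite hK).2 this] with n hn γ hγ hγK
  exact hn γ hγK hγ

/-- The Haar probability measures `λ_n` of `Fix_{Γ_n}(X_f)` (characterized as Borel
probability measures concentrated on `Fix_{Γ_n}(X_f)` and invariant under translation by
its elements) converge in the weak* topology to the Haar probability measure `λ` of
`X_f` (characterized similarly). -/
theorem stmt14 {G : Type*} [Group G] [Countable G] [Infinite G]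
    (f : G → ℤ) (hf : WellBalancedZ f)
    (N : ℕ → Subgroup G) (hnorm : ∀ n, (N n).Normal) (hfin : ∀ n, (N n).FiniteIndex)
    (hconv : (⋂ n : ℕ, ⋃ i : ℕ, ⋃ (_ : n ≤ i), ((N i : Set G))) = {1})
    (lamn : ℕ → Measure (G → UnitAddCircle))
    (hPn : ∀ n, IsProbabilityMeasure (lamn n))
    (hsuppn : ∀ n, lamn n (fixSet f (N n)) = 1)
    (hinvn : ∀ n, ∀ x ∈ fixSet f (N n),
      Measure.map (fun y => y + x) (lamn n) = lamn n)
    (lam : Measure (G → UnitAddCircle)) [IsProbabilityMeasure lam]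
    (hsupp : lam (XfSet f) = 1)
    (hinv : ∀ x ∈ XfSet f, Measure.map (fun y => y + x) lam = lam) :
    ∀ φ : (G → UnitAddCircle) → ℝ, Continuous φ →
      Tendsto (fun n : ℕ => ∫ x, φ x ∂(lamn n)) atTop (𝓝 (∫ x, φ x ∂lam)) := by
  intro φ hφ
  have hC := tendsto_integral_of_torusChar (μn := lamn) (μ := lam) (fun g => ?_)
    ⟨fun x => (φ x : ℂ), by fun_prop⟩
  · simp only [ContinuousMap.coe_mk, integral_complex_ofReal] at hC
    simpa [Function.comp_def] using (Complex.continuous_re.tendsto _).comp hC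
  by_cases hg : g ∈ hf.leftIdeal
  · rw [integral_torusChar_eq_one hsupp fun x hx => (hf.mem_XfSet_iff x).1 hx g hg]
    refine tendsto_const_nhds.congr fun n => ?_
    rw [integral_torusChar_eq_one (hsuppn n) fun x hx =>
      (hf.mem_fixSet_iff (N n) x).1 hx g (hf.leftIdeal_le _ hg)]
  · obtain ⟨x, hx, hxg⟩ := exists_annihilator_ne_zero hg
    rw [integral_torusChar_eq_zero (hinv x ((hf.mem_XfSet_iff x).2 hx)) hxg]
    obtain ⟨K, hK, hKN⟩ := hf.exists_finite_forall_mem_leftIdeal g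
    refine tendsto_const_nhds.congr' ?_
    filter_upwards [eventually_avoid_finite hconv hK] with n hn
    obtain ⟨y, hy, hyg⟩ := exists_annihilator_ne_zero
      (fun h => hg (hKN (N n) hn h) : g ∉ hf.leftIdealMod (N n))
    rw [integral_torusChar_eq_zero (hinvn n y ((hf.mem_fixSet_iff (N n) y).2 hy)) hyg]
end

section
/- Let V be a finite nonempty set and a : V × V → ℕ a symmetric function (a(v,w) = a(w,v)), viewed as the edge-multiplicity function of a finite graph G on vertex set V (loops allowed). Assume G is connected, i.e. the simple graph on V in which distinct v, w are adjacent iff a(v,w) > 0 is connected. Let Δ_G be the V × V real matrix with Δ_G(v,v) = Σ_{w ≠ v} a(v,w) and Δ_G(v,w) = −a(v,w) for v ≠ w, and let X_G = {x : V → ℝ/ℤ : ∀v ∈ V, Σ_{w ≠ v} a(v,w)·(x(v) − x(w)) = 0 in ℝ/ℤ}, a closed subgroup of (ℝ/ℤ)^V with the product topology. Then the number of connected components of X_G is finite and equals, for every choice of v₀ ∈ V, the determinant of the matrix obtained from Δ_G by deleting the row and column indexed by v₀; equivalently, |V| times the number of connected components of X_G equals the product of the nonzero eigenvalues of the symmetric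 matrix Δ_G. -/
open Filter Topology
open scoped Classical

noncomputable section

/-- The graph Laplacian of the finite multigraph on `V` with edge-multiplicity
function `a`. -/
def graphLap {V : Type*} [Fintype V] [DecidableEq V] (a : V → V → ℕ) :
    Matrix V V ℝ :=
  fun v w => if v = w then ∑ u ∈ Finset.univ \ {v}, (a v u : ℝ) else -(a v w : ℝ)

/-- The group of points of `(ℝ/ℤ)^V` which are harmonic modulo 1. -/
def harmSet {V : Type*} [Fintype V] [DecidableEq V] (a : V → V → ℕ) :
    Set (V → UnitAddCircle) :=
  {x | ∀ v : V, (∑ w ∈ Finset.univ \ {v}, a v w • (x v - x w)) = 0}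

open scoped Matrix

/-- The graph Laplacian with integer entries. -/
def intLap {V : Type*} [Fintype V] [DecidableEq V] (a : V → V → ℕ) : Matrix V V ℤ :=
  fun v w => if v = w then ∑ u ∈ Finset.univ \ {v}, (a v u : ℤ) else -(a v w : ℤ)

/-- The integer Laplacian with the row and column of `v₀` deleted. -/
abbrev reducedIntLap {V : Type*} [Fintype V] [DecidableEq V] (a : V → V → ℕ) (v₀ : V) :
    Matrix {v : V // v ≠ v₀} {v : V // v ≠ v₀} ℤ :=
  (intLap a).submatrix (fun i => (i : V)) (fun j => (j : V))

/-- The kernel of an integer matrix acting on a power of the circle. -/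
def torusKer {W : Type*} [Fintype W] (M : Matrix W W ℤ) : Set (W → UnitAddCircle) :=
  {y | ∀ i, ∑ j, M i j • y j = 0}

theorem graphLap_eq_map_intLap {V : Type*} [Fintype V] [DecidableEq V] (a : V → V → ℕ) :
    graphLap a = (intLap a).map (Int.castRingHom ℝ) := by
  ext v w
  by_cases h : v = w <;> simp [graphLap, intLap, h]

theorem sum_sdiff_smul_sub {V A : Type*} [Fintype V] [DecidableEq V] [AddCommGroup A]
    (a : V → V → ℕ) (x : V → A) (v : V) :
    ∑ w ∈ Finset.univ \ {v}, a v w • (x v - x w) = ∑ w, a v w • (x v - x w) := by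
  refine Finset.sum_subset (Finset.subset_univ _) fun w _ hw => ?_
  have : w = v := by simpa using hw
  simp [this]

theorem sum_intLap_smul {V A : Type*} [Fintype V] [DecidableEq V] [AddCommGroup A]
    (a : V → V → ℕ) (x : V → A) (v : V) :
    ∑ w, intLap a v w • x w = ∑ w, a v w • (x v - x w) := by
  rw [← sum_sdiff_smul_sub, ← Finset.sum_sdiff (Finset.subset_univ {v})]
  have h : ∑ w ∈ Finset.univ \ {v}, intLap a v w • x w
      = ∑ w ∈ Finset.univ \ {v}, -(a v w • x w) := by
    refine Finset.sum_congr rfl fun w hw => ?_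
    have hvw : v ≠ w := by
      rintro rfl
      simp at hw
    simp [intLap, hvw]
  rw [h, Finset.sum_singleton]
  simp only [intLap, if_true, smul_sub, Finset.sum_sub_distrib, Finset.sum_smul,
    Finset.sum_neg_distrib, natCast_zsmul]
  abel

theorem sum_sum_smul_sub_eq_zero {V A : Type*} [Fintype V] [AddCommGroup A]
    (a : V → V → ℕ) (hsymm : ∀ v w : V, a v w = a w v) (x : V → A) :
    ∑ v, ∑ w, a v w • (x v - x w) = 0 := by
  simp only [smul_sub, Finset.sum_sub_distrib]
  rw [sub_eq_zero, Finset.sum_comm]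
  refine Finset.sum_congr rfl fun v _ => Finset.sum_congr rfl fun w _ => ?_
  rw [hsymm]

theorem sum_reducedIntLap_smul {V A : Type*} [Fintype V] [DecidableEq V] [AddCommGroup A]
    (a : V → V → ℕ) (v₀ : V) (x : V → A) (i : {v : V // v ≠ v₀}) :
    ∑ j, reducedIntLap a v₀ i j • (x j - x v₀) = ∑ w, a i w • (x i - x w) := by
  have h := Fintype.sum_eq_add_sum_subtype_ne
    (fun w => intLap a i w • (x w - x v₀)) v₀
  rw [sum_intLap_smul a (fun w => x w - x v₀)] at h
  simpa using h.symm

/-- An integer matrix of nonzero determinant kills `|det|` points of the torus. -/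
theorem card_torusKer {W : Type*} [Fintype W] [DecidableEq W] (M : Matrix W W ℤ)
    (hM : M.det ≠ 0) : Nat.card (torusKer M) = M.det.natAbs := by
  have hinj : Function.Injective (Matrix.toLin' M) := by
    rw [← LinearMap.ker_eq_bot, LinearMap.ker_eq_bot']
    intro z hz
    by_contra hne
    exact hM (Matrix.exists_mulVec_eq_zero_iff.mp ⟨z, hne, by simpa using hz⟩)
  let e := LinearEquiv.ofInjective (Matrix.toLin' M) hinj
  have hcard := Submodule.natAbs_det_equiv (LinearMap.range (Matrix.toLin' M)) e
  have he : (LinearMap.range (Matrix.toLin' M)).subtype ∘ₗ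
      AddMonoidHom.toIntLinearMap (e : (W → ℤ) →+ _) = Matrix.toLin' M := by
    ext; rfl
  rw [he, LinearMap.det_toLin'] at hcard
  rw [hcard]
  set N : Matrix W W ℝ := M.map (Int.castRingHom ℝ) with hN
  have hNdet : IsUnit N.det := by
    rw [hN, ← RingHom.mapMatrix_apply, ← RingHom.map_det]
    simpa using hM
  have hcast : ∀ z : W → ℤ, N *ᵥ (fun i => (z i : ℝ)) = fun i => ((M *ᵥ z) i : ℝ) := by
    intro z
    ext i
    simp [hN, Matrix.mulVec, dotProduct]
  let φ : (W → ℤ) →+ (W → UnitAddCircle) :=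
    AddMonoidHom.mk' (fun z i => (((N⁻¹ *ᵥ fun j => (z j : ℝ)) i : ℝ) : UnitAddCircle))
      fun z z' => by
        ext i
        have h : (fun j : W => (((z + z') j : ℤ) : ℝ))
          = (fun j => (z j : ℝ)) + fun j => (z' j : ℝ) := by ext; simp
        rw [h, Matrix.mulVec_add]
        rfl
  have hker : φ.toIntLinearMap.ker = LinearMap.range (Matrix.toLin' M) := by
    ext z
    simp only [LinearMap.mem_ker, LinearMap.mem_range, Matrix.toLin'_apply]
    constructor
    · intro hz
      have hz' : ∀ i, ∃ n : ℤ, (n : ℝ) = (N⁻¹ *ᵥ fun j => (z j : ℝ)) i := by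
        intro i
        have := congrFun hz i
        obtain ⟨n, hn⟩ := (AddCircle.coe_eq_zero_iff (1 : ℝ)).mp this
        exact ⟨n, by simpa using hn⟩
      choose n hn using hz'
      refine ⟨n, ?_⟩
      have h1 := hcast n
      rw [funext hn, Matrix.mulVec_mulVec, Matrix.mul_nonsing_inv _ hNdet,
        Matrix.one_mulVec] at h1
      ext i
      exact_mod_cast (congrFun h1 i).symm
    · rintro ⟨n, rfl⟩
      ext i
      change (((N⁻¹ *ᵥ fun j => ((M *ᵥ n) j : ℝ)) i : ℝ) : UnitAddCircle) = 0
      rw [← hcast, Matrix.mulVec_mulVec, Matrix.nonsing_inv_mul _ hNdet, Matrix.one_mulVec]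
      exact (AddCircle.coe_eq_zero_iff (1 : ℝ)).mpr ⟨n i, by simp⟩
  have hcoe : ∀ (y : W → ℝ) i, ∑ j, M i j • ((y j : ℝ) : UnitAddCircle)
      = (((N *ᵥ y) i : ℝ) : UnitAddCircle) := by
    intro y i
    have h : (N *ᵥ y) i = ∑ j, M i j • y j := by
      simp [hN, Matrix.mulVec, dotProduct]
    rw [h]
    exact (map_sum (QuotientAddGroup.mk' (AddSubgroup.zmultiples (1 : ℝ)))
      (fun j => M i j • y j) Finset.univ).symm
  have hrange : (LinearMap.range φ.toIntLinearMap : Set (W → UnitAddCircle)) = torusKer M := by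
    ext y
    constructor
    · rintro ⟨z, rfl⟩ i
      change ∑ j, M i j • (((N⁻¹ *ᵥ fun j => (z j : ℝ)) j : ℝ) : UnitAddCircle) = 0
      rw [hcoe, Matrix.mulVec_mulVec, Matrix.mul_nonsing_inv _ hNdet, Matrix.one_mulVec]
      exact (AddCircle.coe_eq_zero_iff (1 : ℝ)).mpr ⟨z i, by simp⟩
    · intro hy
      have hlift : ∀ i, ∃ r : ℝ, (r : UnitAddCircle) = y i :=
        fun i => QuotientAddGroup.mk_surjective (y i)
      choose r hr using hlift
      have hr' : (fun i => ((r i : ℝ) : UnitAddCircle)) = y := funext hr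
      subst hr'
      have hz : ∀ i, ∃ n : ℤ, (n : ℝ) = (N *ᵥ r) i := by
        intro i
        have := hy i
        rw [hcoe] at this
        obtain ⟨n, hn⟩ := (AddCircle.coe_eq_zero_iff (1 : ℝ)).mp this
        exact ⟨n, by simpa using hn⟩
      choose z hz using hz
      refine ⟨z, ?_⟩
      ext i
      change (((N⁻¹ *ᵥ fun j => (z j : ℝ)) i : ℝ) : UnitAddCircle) = _
      rw [funext hz, Matrix.mulVec_mulVec, Matrix.nonsing_inv_mul _ hNdet, Matrix.one_mulVec]
  rw [← hker, ← hrange]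
  exact (Nat.card_congr φ.toIntLinearMap.quotKerEquivRange.toEquiv).symm

/-- Reducing at `v₀` identifies the connected components of the harmonic points with the
kernel of the reduced Laplacian on the torus, as soon as the latter is finite. -/
theorem connectedComponents_harmSet_equiv {V : Type*} [Fintype V] [DecidableEq V]
    (a : V → V → ℕ) (hsymm : ∀ v w : V, a v w = a w v) (v₀ : V)
    [Finite (torusKer (reducedIntLap a v₀))] :
    Nonempty (ConnectedComponents (harmSet a) ≃ torusKer (reducedIntLap a v₀)) := by
  have hmem : ∀ x : V → UnitAddCircle, x ∈ harmSet a ↔ ∀ v, ∑ w, a v w • (x v - x w) = 0 := by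
    intro x
    simp only [harmSet, Set.mem_ofPred_eq, sum_sdiff_smul_sub]
  let f : harmSet a → torusKer (reducedIntLap a v₀) := fun x =>
    ⟨fun i => x.1 i - x.1 v₀, fun i => by
      rw [sum_reducedIntLap_smul]
      exact (hmem x.1).mp x.2 i⟩
  have hf : Continuous f := by
    refine Continuous.subtype_mk (continuous_pi fun i => ?_) _
    exact ((continuous_apply _).comp continuous_subtype_val).sub
      ((continuous_apply _).comp continuous_subtype_val)
  refine ⟨Equiv.ofBijective hf.connectedComponentsLift ⟨?_, ?_⟩⟩
  · intro p q hpq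
    obtain ⟨x, rfl⟩ := ConnectedComponents.surjective_coe p
    obtain ⟨y, rfl⟩ := ConnectedComponents.surjective_coe q
    have hxy : f x = f y := hpq
    have hdiff : ∀ v, x.1 v - x.1 v₀ = y.1 v - y.1 v₀ := by
      intro v
      by_cases hv : v = v₀
      · simp [hv]
      · exact congrFun (congrArg Subtype.val hxy) ⟨v, hv⟩
    let g : UnitAddCircle → harmSet a := fun t => ⟨fun v => y.1 v + t, by
      rw [hmem]
      intro v
      simpa using (hmem y.1).mp y.2 v⟩
    have hg : Continuous g :=
      Continuous.subtype_mk (continuous_pi fun v => continuous_const.add continuous_id) _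
    rw [ConnectedComponents.coe_eq_coe']
    refine (isPreconnected_range hg).subset_connectedComponent ⟨0, ?_⟩ ⟨x.1 v₀ - y.1 v₀, ?_⟩
    · ext v
      simp [g]
    · ext v
      change y.1 v + (x.1 v₀ - y.1 v₀) = x.1 v
      rw [← sub_add_cancel (x.1 v) (x.1 v₀), hdiff]
      abel
  · intro y
    let x : V → UnitAddCircle := fun v => if hv : v = v₀ then 0 else y.1 ⟨v, hv⟩
    have hx₀ : x v₀ = 0 := by simp [x]
    have hx : ∀ i : {v : V // v ≠ v₀}, x i - x v₀ = y.1 i := by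
      intro i
      rw [hx₀, sub_zero]
      simp [x, i.2]
    have hne : ∀ v, v ≠ v₀ → ∑ w, a v w • (x v - x w) = 0 := by
      intro v hv
      have h := sum_reducedIntLap_smul a v₀ x ⟨v, hv⟩
      rw [← h]
      simp only [hx]
      exact y.2 ⟨v, hv⟩
    have hharm : x ∈ harmSet a := by
      rw [hmem]
      intro v
      by_cases hv : v = v₀
      · subst hv
        rw [← sum_sum_smul_sub_eq_zero a hsymm x]
        exact (Finset.sum_eq_single v (fun w _ hw => hne w hw) (by simp)).symm
      · exact hne v hv
    refine ⟨((⟨x, hharm⟩ : harmSet a) : ConnectedComponents (harmSet a)), ?_⟩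
    rw [Continuous.connectedComponentsLift_apply_coe]
    exact Subtype.ext (funext hx)

theorem graphLap_isHermitian {V : Type*} [Fintype V] [DecidableEq V]
    (a : V → V → ℕ) (hsymm : ∀ v w : V, a v w = a w v) : (graphLap a).IsHermitian := by
  ext v w
  by_cases h : v = w
  · simp [h]
  · simp [graphLap, h, Ne.symm h, hsymm v w]

theorem graphLap_mulVec {V : Type*} [Fintype V] [DecidableEq V] (a : V → V → ℕ)
    (x : V → ℝ) (v : V) : (graphLap a *ᵥ x) v = ∑ w, (a v w : ℝ) * (x v - x w) := by
  have h := sum_intLap_smul a x v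
  simpa [graphLap_eq_map_intLap, Matrix.mulVec, dotProduct] using h

theorem two_mul_dotProduct_graphLap_mulVec {V : Type*} [Fintype V] [DecidableEq V]
    (a : V → V → ℕ) (hsymm : ∀ v w : V, a v w = a w v) (x : V → ℝ) :
    2 * (x ⬝ᵥ graphLap a *ᵥ x) = ∑ v, ∑ w, (a v w : ℝ) * (x v - x w) ^ 2 := by
  have h₁ : x ⬝ᵥ graphLap a *ᵥ x = ∑ v, ∑ w, x v * ((a v w : ℝ) * (x v - x w)) := by
    simp only [dotProduct, graphLap_mulVec, Finset.mul_sum]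
  have h₂ : x ⬝ᵥ graphLap a *ᵥ x = ∑ v, ∑ w, x w * ((a v w : ℝ) * (x w - x v)) := by
    rw [h₁, Finset.sum_comm]
    refine Finset.sum_congr rfl fun v _ => Finset.sum_congr rfl fun w _ => ?_
    rw [hsymm]
  rw [two_mul]
  nth_rewrite 1 [h₁]
  rw [h₂, ← Finset.sum_add_distrib]
  refine Finset.sum_congr rfl fun v _ => ?_
  rw [← Finset.sum_add_distrib]
  exact Finset.sum_congr rfl fun w _ => by ring

theorem eq_of_dotProduct_graphLap_mulVec_nonpos {V : Type*} [Fintype V] [DecidableEq V]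
    (a : V → V → ℕ) (hsymm : ∀ v w : V, a v w = a w v)
    (hconn : (SimpleGraph.fromRel (fun v w : V => 0 < a v w)).Connected)
    (x : V → ℝ) (hx : x ⬝ᵥ graphLap a *ᵥ x ≤ 0) (v w : V) : x v = x w := by
  have hnonneg : ∀ v w, 0 ≤ (a v w : ℝ) * (x v - x w) ^ 2 := fun v w => by positivity
  have hzero : ∑ v, ∑ w, (a v w : ℝ) * (x v - x w) ^ 2 = 0 := by
    refine le_antisymm ?_ (Finset.sum_nonneg fun v _ => Finset.sum_nonneg fun w _ => hnonneg v w)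
    rw [← two_mul_dotProduct_graphLap_mulVec a hsymm]
    linarith
  have hadj : ∀ v w, 0 < a v w → x v = x w := by
    intro v w hvw
    have h₁ := (Finset.sum_eq_zero_iff_of_nonneg
      (fun v _ => Finset.sum_nonneg fun w _ => hnonneg v w)).mp hzero v (Finset.mem_univ v)
    have h₂ := (Finset.sum_eq_zero_iff_of_nonneg
      (fun w _ => hnonneg v w)).mp h₁ w (Finset.mem_univ w)
    have hpos : (a v w : ℝ) ≠ 0 := by exact_mod_cast hvw.ne'
    simpa [hpos, sub_eq_zero] using h₂
  obtain ⟨p⟩ := hconn.preconnected v w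
  induction p with
  | nil => rfl
  | cons h _ ih =>
    rw [← ih]
    rcases (SimpleGraph.fromRel_adj _ _ _).mp h with ⟨-, h | h⟩
    · exact hadj _ _ h
    · exact (hadj _ _ h).symm

theorem det_reduced_graphLap_pos {V : Type*} [Fintype V] [DecidableEq V]
    (a : V → V → ℕ) (hsymm : ∀ v w : V, a v w = a w v)
    (hconn : (SimpleGraph.fromRel (fun v w : V => 0 < a v w)).Connected) (v₀ : V) :
    0 < Matrix.det ((graphLap a).submatrix
      (fun i : {v : V // v ≠ v₀} => (i : V)) (fun j : {v : V // v ≠ v₀} => (j : V))) := by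
  refine Matrix.PosDef.det_pos (Matrix.PosDef.of_dotProduct_mulVec_pos
    ((graphLap_isHermitian a hsymm).submatrix _) fun y hy => ?_)
  let x : V → ℝ := fun v => if hv : v = v₀ then 0 else y ⟨v, hv⟩
  have hx₀ : x v₀ = 0 := by simp [x]
  have hx : ∀ i : {v : V // v ≠ v₀}, x i = y i := fun i => by simp [x, i.2]
  have hform : star y ⬝ᵥ ((graphLap a).submatrix (fun i : {v : V // v ≠ v₀} => (i : V))
      (fun j : {v : V // v ≠ v₀} => (j : V))) *ᵥ y = x ⬝ᵥ graphLap a *ᵥ x := by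
    simp only [dotProduct, Matrix.mulVec]
    rw [Fintype.sum_eq_add_sum_subtype_ne _ v₀, hx₀, zero_mul, zero_add]
    refine Finset.sum_congr rfl fun i _ => ?_
    rw [Fintype.sum_eq_add_sum_subtype_ne _ v₀, hx₀, mul_zero, zero_add]
    simp [hx]
  rw [hform]
  by_contra hle
  refine hy (funext fun i => ?_)
  rw [← hx, eq_of_dotProduct_graphLap_mulVec_nonpos a hsymm hconn x (not_lt.mp hle) i v₀, hx₀]
  rfl

theorem adjugate_apply_self {n R : Type*} [Fintype n] [DecidableEq n] [CommRing R]
    (A : Matrix n n R) (i : n) :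
    A.adjugate i i = (A.submatrix (fun j : {j : n // j ≠ i} => (j : n))
      (fun j : {j : n // j ≠ i} => (j : n))).det := by
  rw [Matrix.adjugate_apply, Matrix.twoBlockTriangular_det _ (fun j => j ≠ i)]
  · have h₁ : (A.updateRow i (Pi.single i 1)).toSquareBlockProp (fun j => j ≠ i)
        = A.submatrix (fun j : {j : n // j ≠ i} => (j : n))
          (fun j : {j : n // j ≠ i} => (j : n)) := by
      ext j k
      simp [Matrix.toSquareBlockProp, Matrix.updateRow_ne j.2]
    have h₂ : (A.updateRow i (Pi.single i 1)).toSquareBlockProp (fun j => ¬ j ≠ i) = 1 := by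
      ext ⟨j, hj⟩ ⟨k, hk⟩
      obtain rfl := not_not.mp hj
      obtain rfl := not_not.mp hk
      simp [Matrix.toSquareBlockProp]
    rw [h₁, h₂, Matrix.det_one, mul_one]
  · intro j hj k hk
    obtain rfl := not_not.mp hj
    simp [hk]

theorem trace_adjugate_eq_sum_prod_eigenvalues {n : Type*} [Fintype n] [DecidableEq n]
    {A : Matrix n n ℝ} (hA : A.IsHermitian) :
    A.adjugate.trace = ∑ i, ∏ j ∈ Finset.univ.erase i, hA.eigenvalues j := by
  have hU : star (hA.eigenvectorUnitary : Matrix n n ℝ) * hA.eigenvectorUnitary = 1 :=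
    Unitary.coe_star_mul_self hA.eigenvectorUnitary
  conv_lhs => rw [hA.spectral_theorem, Unitary.conjStarAlgAut_apply]
  rw [Matrix.adjugate_mul_distrib, Matrix.adjugate_mul_distrib, Matrix.trace_mul_comm,
    Matrix.mul_assoc, ← Matrix.adjugate_mul_distrib, hU, Matrix.adjugate_one, Matrix.mul_one,
    Matrix.adjugate_diagonal, Matrix.trace_diagonal]
  rfl

theorem det_graphLap {V : Type*} [Fintype V] [DecidableEq V] [Nonempty V] (a : V → V → ℕ) :
    (graphLap a).det = 0 := by
  refine Matrix.exists_mulVec_eq_zero_iff.mp ⟨1, one_ne_zero, ?_⟩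
  ext v
  simp [graphLap_mulVec]

theorem sum_prod_erase_eq_prod_filter {n : Type*} [Fintype n] [DecidableEq n] (μ : n → ℝ)
    (hprod : ∏ i, μ i = 0) (hsum : ∑ i, ∏ j ∈ Finset.univ.erase i, μ j ≠ 0) :
    ∑ i, ∏ j ∈ Finset.univ.erase i, μ j = ∏ i ∈ Finset.univ.filter (fun i => μ i ≠ 0), μ i := by
  obtain ⟨i₀, -, hi₀⟩ := Finset.prod_eq_zero_iff.mp hprod
  have h : ∑ i, ∏ j ∈ Finset.univ.erase i, μ j = ∏ j ∈ Finset.univ.erase i₀, μ j := by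
    refine Finset.sum_eq_single i₀ (fun i _ hi => ?_) (by simp)
    exact Finset.prod_eq_zero (Finset.mem_erase.mpr ⟨hi.symm, Finset.mem_univ _⟩) hi₀
  rw [h] at hsum ⊢
  have hne := Finset.prod_ne_zero_iff.mp hsum
  congr 1
  ext i
  simp only [Finset.mem_erase, Finset.mem_univ, and_true, Finset.mem_filter, true_and]
  exact ⟨fun hi => hne i (by simpa using hi), by rintro hi rfl; exact hi hi₀⟩

/-- For a finite connected multigraph `G` on `V`: the set `X_G` of points harmonic mod 1
has finitely many connected components; their number equals the determinant of the
Laplacian with the row and column of any vertex `v₀` deleted; and equivalently `|V|`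
times the number of components equals the product of the nonzero eigenvalues of the
symmetric matrix `Δ_G`. -/
theorem stmt17 {V : Type*} [Fintype V] [DecidableEq V] [Nonempty V]
    (a : V → V → ℕ) (hsymm : ∀ v w : V, a v w = a w v)
    (hconn : (SimpleGraph.fromRel (fun v w : V => 0 < a v w)).Connected) :
    Finite (ConnectedComponents (harmSet a)) ∧
    (∀ v₀ : V,
      Matrix.det ((graphLap a).submatrix
          (fun i : {v : V // v ≠ v₀} => (i : V)) (fun j : {v : V // v ≠ v₀} => (j : V)))
        = (Nat.card (ConnectedComponents (harmSet a)) : ℝ)) ∧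
    (∀ hA : (graphLap a).IsHermitian,
      (Fintype.card V : ℝ) * (Nat.card (ConnectedComponents (harmSet a)) : ℝ)
        = ∏ i ∈ Finset.univ.filter (fun i : V => hA.eigenvalues i ≠ 0),
            hA.eigenvalues i) := by
  have hcard : ∀ v₀ : V, Finite (ConnectedComponents (harmSet a)) ∧
      Matrix.det ((graphLap a).submatrix
          (fun i : {v : V // v ≠ v₀} => (i : V)) (fun j : {v : V // v ≠ v₀} => (j : V)))
        = (Nat.card (ConnectedComponents (harmSet a)) : ℝ) := by
    intro v₀
    have hpos := det_reduced_graphLap_pos a hsymm hconn v₀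
    have hdet : Matrix.det ((graphLap a).submatrix
        (fun i : {v : V // v ≠ v₀} => (i : V)) (fun j : {v : V // v ≠ v₀} => (j : V)))
        = ((reducedIntLap a v₀).det : ℝ) := by
      rw [graphLap_eq_map_intLap, Matrix.submatrix_map, ← RingHom.mapMatrix_apply,
        ← RingHom.map_det]
      rfl
    rw [hdet] at hpos ⊢
    have hpos' : 0 < (reducedIntLap a v₀).det := by exact_mod_cast hpos
    have hker := card_torusKer (reducedIntLap a v₀) hpos'.ne'
    have : Finite (torusKer (reducedIntLap a v₀)) :=
      Nat.finite_of_card_ne_zero (by rw [hker]; exact Int.natAbs_ne_zero.mpr hpos'.ne')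
    obtain ⟨e⟩ := connectedComponents_harmSet_equiv a hsymm v₀
    refine ⟨Finite.of_equiv _ e.symm, ?_⟩
    rw [Nat.card_congr e, hker, Nat.cast_natAbs, abs_of_pos hpos']
  refine ⟨(hcard (Classical.arbitrary V)).1, fun v₀ => (hcard v₀).2, fun hA => ?_⟩
  have htrace : (graphLap a).adjugate.trace
      = (Fintype.card V : ℝ) * (Nat.card (ConnectedComponents (harmSet a)) : ℝ) := by
    simp only [Matrix.trace, Matrix.diag_apply, adjugate_apply_self, fun v₀ => (hcard v₀).2,
      Finset.sum_const, Finset.card_univ, nsmul_eq_mul]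
  have hne : (graphLap a).adjugate.trace ≠ 0 := by
    have hpos := det_reduced_graphLap_pos a hsymm hconn (Classical.arbitrary V)
    rw [(hcard _).2] at hpos
    rw [htrace]
    exact mul_ne_zero (by exact_mod_cast Fintype.card_ne_zero) hpos.ne'
  rw [← htrace]
  rw [trace_adjugate_eq_sum_prod_eigenvalues hA] at hne ⊢
  have hprod : ∏ i, hA.eigenvalues i = 0 := by
    simpa [det_graphLap] using hA.det_eq_prod_eigenvalues.symm
  convert sum_prod_erase_eq_prod_filter hA.eigenvalues hprod hne
end
end
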